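/- Let k ≤ m ≤ n, let r_1,…,r_m and c_1,…,c_n be positive reals, and suppose 0 < r_1 < r_1'. Then E(k,r_1,r_2,…,r_m,c) > E(k,r_1',r_2,…,r_m,c); that is, E(k,r,c) is strictly decreasing in each r_i (and, by symmetry, in each c_j). -/

import Mathlib

open MeasureTheory Filter

/-- A `k`-assignment of an `m × n` matrix: a set of `k` positions,
no two in the same row or column. -/
def IsAssignF (m n k : ℕ) (S : Finset (Fin m × Fin n)) : Prop :=
  S.card = k ∧ ∀ p ∈ S, ∀ q ∈ S, p ≠ q → p.1 ≠ q.1 ∧ p.2 ≠ q.2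

/-- The value `min_k(x)` of a minimum `k`-assignment of the matrix `x`. -/
noncomputable def minAssign (m n k : ℕ) (x : Fin m × Fin n → ℝ) : ℝ :=
  sInf {v | ∃ S : Finset (Fin m × Fin n), IsAssignF m n k S ∧ v = ∑ p ∈ S, x p}

/-- The law of a random exponential `m × n` matrix whose entry `(i,j)` has rate
`r i * c j` (rates indexed by naturals, rows `0,…,m−1` and columns `0,…,n−1`):
the measure on `(Fin m × Fin n) → ℝ` with the product exponential density with
respect to Lebesgue measure. -/
noncomputable def rankOneMeasure (m n : ℕ) (r c : ℕ → ℝ) :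
    Measure ((Fin m × Fin n) → ℝ) :=
  volume.withDensity fun x => ENNReal.ofReal
    (∏ p : Fin m × Fin n,
      if 0 ≤ x p then (r p.1.val * c p.2.val) * Real.exp (-((r p.1.val * c p.2.val) * x p))
      else 0)

/-- `E(k, r₀…r_{m−1}, c₀…c_{n−1})`: the expected value of the minimum `k`-assignment of a
random exponential `m × n` matrix with rank 1 rate matrix `(r i * c j)`. -/
noncomputable def Emin (k m n : ℕ) (r c : ℕ → ℝ) : ℝ :=
  ∫ x, minAssign m n k x ∂(rankOneMeasure m n r c)

section Assignments

variable {m n k : ℕ}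

lemma IsAssignF.exists_of_le (hkm : k ≤ m) (hmn : m ≤ n) : ∃ S, IsAssignF m n k S := by
  refine ⟨Finset.univ.image fun i : Fin k => (Fin.castLE hkm i, Fin.castLE (hkm.trans hmn) i),
    ?_, ?_⟩
  · rw [Finset.card_image_of_injective, Finset.card_univ, Fintype.card_fin]
    intro i j h
    simpa using congrArg Prod.fst h
  · simp only [Finset.mem_image, Finset.mem_univ, true_and]
    rintro _ ⟨i, rfl⟩ _ ⟨j, rfl⟩ h
    simpa using h

lemma finite_assignment_values (x : Fin m × Fin n → ℝ) :
    {v | ∃ S : Finset (Fin m × Fin n), IsAssignF m n k S ∧ v = ∑ p ∈ S, x p}.Finite :=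
  (Set.finite_range fun S : Finset (Fin m × Fin n) => ∑ p ∈ S, x p).subset <| by
    rintro _ ⟨S, -, rfl⟩
    exact ⟨S, rfl⟩

lemma minAssign_le {S : Finset (Fin m × Fin n)} (hS : IsAssignF m n k S)
    (x : Fin m × Fin n → ℝ) : minAssign m n k x ≤ ∑ p ∈ S, x p :=
  csInf_le (finite_assignment_values x).bddBelow ⟨S, hS, rfl⟩

lemma exists_minAssign_eq (hkm : k ≤ m) (hmn : m ≤ n) (x : Fin m × Fin n → ℝ) :
    ∃ S, IsAssignF m n k S ∧ minAssign m n k x = ∑ p ∈ S, x p := by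
  obtain ⟨S, hS⟩ := IsAssignF.exists_of_le hkm hmn
  have hne : {v | ∃ S : Finset (Fin m × Fin n),
      IsAssignF m n k S ∧ v = ∑ p ∈ S, x p}.Nonempty := ⟨_, S, hS, rfl⟩
  exact hne.csInf_mem (finite_assignment_values x)

lemma minAssign_nonneg (hkm : k ≤ m) (hmn : m ≤ n) {x : Fin m × Fin n → ℝ}
    (hx : ∀ p, 0 ≤ x p) : 0 ≤ minAssign m n k x := by
  obtain ⟨S, -, h⟩ := exists_minAssign_eq hkm hmn x
  exact h ▸ Finset.sum_nonneg fun p _ => hx p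

lemma minAssign_le_sum (hkm : k ≤ m) (hmn : m ≤ n) {x : Fin m × Fin n → ℝ}
    (hx : ∀ p, 0 ≤ x p) : minAssign m n k x ≤ ∑ p, x p := by
  obtain ⟨S, -, h⟩ := exists_minAssign_eq hkm hmn x
  exact h ▸ Finset.sum_le_univ_sum_of_nonneg hx

lemma minAssign_mono (hkm : k ≤ m) (hmn : m ≤ n) {x y : Fin m × Fin n → ℝ}
    (hxy : ∀ p, x p ≤ y p) : minAssign m n k x ≤ minAssign m n k y := by
  obtain ⟨S, hS, h⟩ := exists_minAssign_eq hkm hmn y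
  exact h ▸ (minAssign_le hS x).trans (Finset.sum_le_sum fun p _ => hxy p)

lemma measurable_minAssign : Measurable (minAssign m n k) := by
  have h : minAssign m n k = fun x =>
      ⨅ S : {S : Finset (Fin m × Fin n) // IsAssignF m n k S}, ∑ p ∈ S.1, x p := by
    funext x
    rw [minAssign, iInf]
    congr 1
    ext v
    simp [eq_comm]
  rw [h]
  exact .iInf fun S => by fun_prop

/-- If every entry of row `i₀` is smaller than every entry outside that row, a minimum
assignment uses row `i₀`. -/
lemma exists_mem_row_of_minAssign_eq (hk : 0 < k) {x : Fin m × Fin n → ℝ} {i₀ : Fin m}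
    (hx : ∀ i j, i ≠ i₀ → x (i₀, j) < x (i, j)) {S : Finset (Fin m × Fin n)}
    (hS : IsAssignF m n k S) (hmin : minAssign m n k x = ∑ p ∈ S, x p) :
    ∃ p ∈ S, p.1 = i₀ := by
  classical
  by_contra! hrow
  obtain ⟨⟨i, j⟩, hp⟩ := Finset.card_pos.1 (hS.1 ▸ hk)
  have hnot : (i₀, j) ∉ S.erase (i, j) := fun h => hrow _ (Finset.mem_of_mem_erase h) rfl
  have hS' : IsAssignF m n k (insert (i₀, j) (S.erase (i, j))) := by
    refine ⟨?_, ?_⟩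
    · rw [Finset.card_insert_of_notMem hnot, Finset.card_erase_of_mem hp, hS.1]
      omega
    · intro p hp' q hq' hpq
      rw [Finset.mem_insert, Finset.mem_erase] at hp' hq'
      rcases hp' with rfl | ⟨hp1, hp2⟩ <;> rcases hq' with rfl | ⟨hq1, hq2⟩
      · exact absurd rfl hpq
      · exact ⟨(hrow q hq2).symm, (hS.2 _ hp _ hq2 hq1.symm).2⟩
      · exact ⟨hrow p hp2, (hS.2 _ hp2 _ hp hp1).2⟩
      · exact hS.2 p hp2 q hq2 hpq
  have h := minAssign_le hS' x
  rw [Finset.sum_insert hnot, hmin, ← Finset.add_sum_erase S x hp] at h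
  linarith [hx i j (hrow _ hp)]

lemma minAssign_lt (hk : 0 < k) (hkm : k ≤ m) (hmn : m ≤ n) {x y : Fin m × Fin n → ℝ}
    {i₀ : Fin m} (hx : ∀ i j, i ≠ i₀ → x (i₀, j) < x (i, j)) (hyx : ∀ p, y p ≤ x p)
    (hlt : ∀ j, y (i₀, j) < x (i₀, j)) : minAssign m n k y < minAssign m n k x := by
  obtain ⟨S, hS, h⟩ := exists_minAssign_eq hkm hmn x
  obtain ⟨⟨i, j⟩, hp, rfl⟩ := exists_mem_row_of_minAssign_eq hk hx hS h
  rw [h]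
  exact (minAssign_le hS y).trans_lt
    (Finset.sum_lt_sum (fun p _ => hyx p) ⟨_, hp, hlt j⟩)

end Assignments

section Exponential

/-- The density of the exponential distribution with rate `a`. -/
noncomputable def expDensity (a t : ℝ) : ℝ :=
  if 0 ≤ t then a * Real.exp (-(a * t)) else 0

lemma expDensity_nonneg {a : ℝ} (ha : 0 < a) (t : ℝ) : 0 ≤ expDensity a t := by
  unfold expDensity
  split_ifs <;> positivity

lemma measurable_expDensity (a : ℝ) : Measurable (expDensity a) :=
  Measurable.ite measurableSet_Ici (by fun_prop) measurable_const

lemma mul_expDensity_mul {d : ℝ} (hd : 0 < d) (a t : ℝ) :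
    d * expDensity a (d * t) = expDensity (d * a) t := by
  simp only [expDensity, mul_nonneg_iff_of_pos_left hd]
  split_ifs
  · ring_nf
  · simp

lemma integrable_pow_mul_expDensity {a : ℝ} (ha : 0 < a) (s : ℕ) :
    Integrable fun t => t ^ s * expDensity a t := by
  have h : IntegrableOn (fun t : ℝ => t ^ s * (a * Real.exp (-(a * t)))) (Set.Ioi 0) := by
    have := (integrableOn_rpow_mul_exp_neg_mul_rpow (s := s) (p := 1) (b := a)
      (neg_one_lt_zero.trans_le s.cast_nonneg) one_pos ha).const_mul a
    refine IntegrableOn.congr_fun this (fun t _ => ?_) measurableSet_Ioi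
    simp only [Real.rpow_natCast, Real.rpow_one, neg_mul]
    ring
  rw [← integrableOn_Ici_iff_integrableOn_Ioi, ← integrable_indicator_iff measurableSet_Ici] at h
  refine h.congr (.of_forall fun t => ?_)
  by_cases ht : 0 ≤ t <;> simp [expDensity, ht]

variable {ι : Type*} [Fintype ι]

/-- The joint density of independent exponential variables with rates `a i`. -/
noncomputable def expProdDensity (a : ι → ℝ) (x : ι → ℝ) : ℝ := ∏ i, expDensity (a i) (x i)

lemma expProdDensity_nonneg {a : ι → ℝ} (ha : ∀ i, 0 < a i) (x : ι → ℝ) :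
    0 ≤ expProdDensity a x :=
  Finset.prod_nonneg fun i _ => expDensity_nonneg (ha i) _

lemma expProdDensity_pos {a : ι → ℝ} (ha : ∀ i, 0 < a i) {x : ι → ℝ} (hx : ∀ i, 0 ≤ x i) :
    0 < expProdDensity a x :=
  Finset.prod_pos fun i _ => by
    rw [expDensity, if_pos (hx i)]
    exact mul_pos (ha i) (Real.exp_pos _)

lemma nonneg_of_expProdDensity_ne_zero {a x : ι → ℝ} (h : expProdDensity a x ≠ 0) (i : ι) :
    0 ≤ x i := by
  by_contra hx
  exact Finset.prod_ne_zero_iff.1 h i (Finset.mem_univ i) (if_neg hx)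

lemma measurable_expProdDensity (a : ι → ℝ) : Measurable (expProdDensity a) :=
  Finset.measurable_fun_prod _ fun i _ => (measurable_expDensity (a i)).comp (measurable_pi_apply i)

lemma integrable_expProdDensity_mul_coord {a : ι → ℝ} (ha : ∀ i, 0 < a i) (i : ι) :
    Integrable fun x : ι → ℝ => expProdDensity a x * x i := by
  classical
  have h := Integrable.fintype_prod (μ := fun _ : ι => (volume : Measure ℝ))
    (f := fun j t => t ^ (if j = i then 1 else 0) * expDensity (a j) t)
    fun j => integrable_pow_mul_expDensity (ha j) _
  refine h.congr (.of_forall fun x => ?_)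
  simp only [Finset.prod_mul_distrib, expProdDensity, pow_ite, pow_one, pow_zero,
    Finset.prod_ite_eq', Finset.mem_univ, if_true]
  exact mul_comm _ _

lemma integral_expProdDensity_mul_comp {a d : ι → ℝ} (hd : ∀ i, 0 < d i)
    {F : (ι → ℝ) → ℝ} (hF : Measurable F) :
    ∫ x, expProdDensity a x * F x = ∫ x, expProdDensity (d * a) x * F (d * x) := by
  classical
  have hdet : 0 < (Matrix.diagonal d).det := by
    rw [Matrix.det_diagonal]
    exact Finset.prod_pos fun i _ => hd i
  have hT : ∀ x, Matrix.toLin' (Matrix.diagonal d) x = d * x := fun x => by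
    ext i
    simp [Matrix.mulVec_diagonal]
  have hmeas : Measurable (Matrix.toLin' (Matrix.diagonal d)) :=
    (LinearMap.continuous_on_pi _).measurable
  conv_lhs => rw [← Real.smul_map_diagonal_volume_pi hdet.ne']
  rw [integral_smul_measure, integral_map hmeas.aemeasurable
    (f := fun x => expProdDensity a x * F x)
    ((measurable_expProdDensity a).mul hF).aestronglyMeasurable, abs_of_pos hdet,
    ENNReal.toReal_ofReal hdet.le, ← integral_smul]
  congr 1
  funext x
  rw [hT, Matrix.det_diagonal, smul_eq_mul, ← mul_assoc, expProdDensity,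
    ← Finset.prod_mul_distrib]
  congr 1
  exact Finset.prod_congr rfl fun i _ => mul_expDensity_mul (hd i) _ _

end Exponential

section Expectation

variable {m n k : ℕ}

lemma integrable_expProdDensity_mul_minAssign (hkm : k ≤ m) (hmn : m ≤ n)
    {a : Fin m × Fin n → ℝ} (ha : ∀ p, 0 < a p) {F : (Fin m × Fin n → ℝ) → ℝ}
    (hF : Measurable F)
    (hFb : ∀ x, (∀ p, 0 ≤ x p) → 0 ≤ F x ∧ F x ≤ minAssign m n k x) :
    Integrable fun x => expProdDensity a x * F x := by
  refine (integrable_finsetSum Finset.univ fun p _ =>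
    integrable_expProdDensity_mul_coord ha p).mono'
    ((measurable_expProdDensity a).mul hF).aestronglyMeasurable (.of_forall fun x => ?_)
  rw [← Finset.mul_sum]
  by_cases h : expProdDensity a x = 0
  · simp [h]
  · have hx := nonneg_of_expProdDensity_ne_zero h
    have h0 := expProdDensity_nonneg ha x
    rw [Real.norm_of_nonneg (mul_nonneg h0 (hFb x hx).1)]
    exact mul_le_mul_of_nonneg_left ((hFb x hx).2.trans (minAssign_le_sum hkm hmn hx)) h0

lemma Emin_eq_integral {r c : ℕ → ℝ} (hr : ∀ i < m, 0 < r i) (hc : ∀ j < n, 0 < c j) :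
    Emin k m n r c = ∫ x, expProdDensity
      (fun p : Fin m × Fin n => r p.1.val * c p.2.val) x * minAssign m n k x := by
  have ha : ∀ p : Fin m × Fin n, 0 < r p.1.val * c p.2.val :=
    fun p => mul_pos (hr _ p.1.2) (hc _ p.2.2)
  change ∫ x, minAssign m n k x ∂(volume.withDensity fun x => ENNReal.ofReal
    (expProdDensity (fun p : Fin m × Fin n => r p.1.val * c p.2.val) x)) = _
  rw [integral_withDensity_eq_integral_toReal_smul
    (measurable_expProdDensity _).ennreal_ofReal (.of_forall fun _ => ENNReal.ofReal_lt_top)]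
  simp only [ENNReal.toReal_ofReal (expProdDensity_nonneg ha _), smul_eq_mul]

/-- Shrinking the entries of one row by a factor in `(0, 1)` strictly decreases the expected
minimum assignment. -/
lemma integral_minAssign_mul_lt (hk : 0 < k) (hkm : k ≤ m) (hmn : m ≤ n)
    {a d : Fin m × Fin n → ℝ} (ha : ∀ p, 0 < a p) (hd : ∀ p, 0 < d p) (hd1 : ∀ p, d p ≤ 1)
    {i₀ : Fin m} (hlt : ∀ j, d (i₀, j) < 1) :
    ∫ x, expProdDensity a x * minAssign m n k (d * x) <
      ∫ x, expProdDensity a x * minAssign m n k x := by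
  have hdx : ∀ {x : Fin m × Fin n → ℝ}, (∀ p, 0 ≤ x p) → ∀ p, (d * x) p ≤ x p :=
    fun hx p => mul_le_of_le_one_left (hx p) (hd1 p)
  have hle : ∀ {x : Fin m × Fin n → ℝ}, (∀ p, 0 ≤ x p) →
      minAssign m n k (d * x) ≤ minAssign m n k x :=
    fun hx => minAssign_mono hkm hmn (hdx hx)
  have h_int := integrable_expProdDensity_mul_minAssign hkm hmn ha measurable_minAssign
    fun x hx => ⟨minAssign_nonneg hkm hmn hx, le_rfl⟩
  have h_int_mul := integrable_expProdDensity_mul_minAssign hkm hmn ha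
    (F := fun x => minAssign m n k (d * x))
    (measurable_minAssign.comp (measurable_const.mul measurable_id)) fun x hx =>
      ⟨minAssign_nonneg hkm hmn fun p => mul_nonneg (hd p).le (hx p), hle hx⟩
  rw [← sub_pos, ← integral_sub h_int h_int_mul]
  refine (integral_pos_iff_support_of_nonneg ?_ (h_int.sub h_int_mul)).2 ?_
  rotate_left
  · let U : Set (Fin m × Fin n → ℝ) :=
      Set.univ.pi fun p => if p.1 = i₀ then Set.Ioo 0 1 else Set.Ioo 1 2
    have hU : IsOpen U := isOpen_set_pi Set.finite_univ fun p _ => by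
      split_ifs <;> exact isOpen_Ioo
    have hne : U.Nonempty := Set.univ_pi_nonempty_iff.2 fun p => by
      split_ifs <;> exact Set.nonempty_Ioo.2 (by norm_num)
    refine (hU.measure_pos volume hne).trans_le (measure_mono fun x hx => ?_)
    have hrow : ∀ j, x (i₀, j) ∈ Set.Ioo (0 : ℝ) 1 := fun j => by
      simpa using hx (i₀, j) trivial
    have hother : ∀ i j, i ≠ i₀ → x (i, j) ∈ Set.Ioo (1 : ℝ) 2 := fun i j hij => by
      simpa [hij] using hx (i, j) trivial
    have hx0 : ∀ p, 0 ≤ x p := by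
      rintro ⟨i, j⟩
      by_cases hi : i = i₀
      · exact hi ▸ (hrow j).1.le
      · exact zero_le_one.trans (hother i j hi).1.le
    have hM : minAssign m n k (d * x) < minAssign m n k x :=
      minAssign_lt hk hkm hmn (fun i j hi => (hrow j).2.trans (hother i j hi).1) (hdx hx0)
        fun j => mul_lt_of_lt_one_left (hrow j).1 (hlt j)
    rw [Function.mem_support, Pi.sub_apply, ← mul_sub]
    exact (mul_pos (expProdDensity_pos ha hx0) (sub_pos.2 hM)).ne'
  · intro x
    rw [Pi.sub_apply, ← mul_sub]
    by_cases h : expProdDensity a x = 0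
    · simp [h]
    · exact mul_nonneg (expProdDensity_nonneg ha x)
        (sub_nonneg.2 (hle (nonneg_of_expProdDensity_ne_zero h)))

end Expectation

/-- `E(k,r,c)` is strictly decreasing in each rate: increasing `r₁` (the rate of the first
row, index `0`) strictly decreases the expected minimum `k`-assignment. -/
theorem Emin_strict_anti (k m n : ℕ) (hk : 0 < k) (hkm : k ≤ m) (hmn : m ≤ n)
    (r c : ℕ → ℝ) (hr : ∀ i < m, 0 < r i) (hc : ∀ j < n, 0 < c j)
    (r₁' : ℝ) (h₁ : r 0 < r₁') :
    Emin k m n (Function.update r 0 r₁') c < Emin k m n r c := by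
  have hm : 0 < m := hk.trans_le hkm
  have hr0 := hr 0 hm
  have hr1 : 0 < r₁' := hr0.trans h₁
  have hr' : ∀ i < m, 0 < Function.update r 0 r₁' i := fun i hi => by
    rcases eq_or_ne i 0 with rfl | h
    · simpa using hr1
    · simpa [h] using hr i hi
  let d : Fin m × Fin n → ℝ := fun p => r p.1.val / Function.update r 0 r₁' p.1.val
  have hd : ∀ p, 0 < d p := fun p => div_pos (hr _ p.1.2) (hr' _ p.1.2)
  have hlt : ∀ j, d (⟨0, hm⟩, j) < 1 := fun j => by simpa [d] using (div_lt_one hr1).2 h₁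
  have hd1 : ∀ p, d p ≤ 1 := by
    rintro ⟨i, j⟩
    rcases eq_or_ne i ⟨0, hm⟩ with rfl | h
    · exact (hlt j).le
    · have h0 : (i : ℕ) ≠ 0 := fun h' => h (Fin.ext h')
      simp [d, h0, (hr i i.2).ne']
  have hda : d * (fun p => Function.update r 0 r₁' p.1.val * c p.2.val) =
      fun p => r p.1.val * c p.2.val := by
    funext p
    simp only [Pi.mul_apply, d, ← mul_assoc, div_mul_cancel₀ _ (hr' _ p.1.2).ne']
  rw [Emin_eq_integral hr hc, Emin_eq_integral hr' hc,
    integral_expProdDensity_mul_comp hd measurable_minAssign, hda]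
  exact integral_minAssign_mul_lt hk hkm hmn
    (fun p => mul_pos (hr _ p.1.2) (hc _ p.2.2)) hd hd1 hlt
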